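/- Let A be a continuous connection form on Ω × W and I ⊆ ℝ an interval. Suppose x, x_n ∈ C¹(I, Ω) for n ∈ ℕ, with x_n → x and x_n′ → x′ uniformly on compact subsets of I, suppose each ξ_n ∈ C¹(I, W) is a parallel lift of x_n, and suppose ξ_n → ξ uniformly on compact subsets of I for some ξ : I → W. Then ξ is C¹ and is a parallel lift of x. -/

import Mathlib

open scoped Topology

open Filter Set

/-- An order connected set of reals contains a compact relative neighborhood of each of its
points. -/
lemma Set.OrdConnected.exists_isCompact_mem_nhdsWithin {I : Set ℝ} (hI : I.OrdConnected) {t : ℝ}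
    (ht : t ∈ I) : ∃ K ⊆ I, IsCompact K ∧ t ∈ K ∧ K ∈ 𝓝[I] t := by
  obtain ⟨a, haI, hat, ha⟩ : ∃ a ∈ I, a ≤ t ∧ ∀ᶠ s in 𝓝[I] t, a ≤ s := by
    by_cases h : ∃ a ∈ I, a < t
    · obtain ⟨a, haI, hat⟩ := h
      exact ⟨a, haI, hat.le, nhdsWithin_le_nhds (Ici_mem_nhds hat)⟩
    · push Not at h
      exact ⟨t, ht, le_rfl, eventually_mem_nhdsWithin.mono h⟩
  obtain ⟨b, hbI, htb, hb⟩ : ∃ b ∈ I, t ≤ b ∧ ∀ᶠ s in 𝓝[I] t, s ≤ b := by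
    by_cases h : ∃ b ∈ I, t < b
    · obtain ⟨b, hbI, htb⟩ := h
      exact ⟨b, hbI, htb.le, nhdsWithin_le_nhds (Iic_mem_nhds htb)⟩
    · push Not at h
      exact ⟨t, ht, le_rfl, eventually_mem_nhdsWithin.mono h⟩
  exact ⟨Icc a b, hI.out haI hbI, isCompact_Icc, ⟨hat, htb⟩, ha.and hb⟩

/-- A uniform limit that is continuous at a point is also a joint limit there. -/
lemma TendstoUniformlyOn.tendsto_uncurry_nhdsWithin {ι X E : Type*} [TopologicalSpace X]
    [UniformSpace E] {l : Filter ι} {F : ι → X → E} {f : X → E} {K : Set X} {t : X}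
    (h : TendstoUniformlyOn F f l K) (hf : ContinuousWithinAt f K t) :
    Tendsto (fun p : ι × X => F p.1 p.2) (l ×ˢ 𝓝[K] t) (𝓝 (f t)) := by
  rw [tendstoUniformlyOn_iff_tendsto] at h
  exact (hf.tendsto.comp tendsto_snd).congr_uniformity
    (h.mono_left (prod_mono le_rfl inf_le_right))

/-- If the derivatives of a pointwise convergent sequence of functions on an order connected set
converge jointly to `L` at `t`, then the limit function has derivative `L` at `t`. -/
lemma Set.OrdConnected.hasDerivWithinAt_of_tendsto_prod {W : Type*} [NormedAddCommGroup W]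
    [NormedSpace ℝ W] {I : Set ℝ} (hI : I.OrdConnected) {f f' : ℕ → ℝ → W} {g : ℝ → W} {L : W}
    {t : ℝ} (ht : t ∈ I) (hf : ∀ n, ∀ s ∈ I, HasDerivWithinAt (f n) (f' n s) I s)
    (hg : ∀ s ∈ I, Tendsto (fun n => f n s) atTop (𝓝 (g s)))
    (hL : Tendsto (fun p : ℕ × ℝ => f' p.1 p.2) (atTop ×ˢ 𝓝[I] t) (𝓝 L)) :
    HasDerivWithinAt g L I t := by
  rw [hasDerivWithinAt_iff_isLittleO, Asymptotics.isLittleO_iff]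
  intro ε hε
  have hev := hL.eventually (Metric.closedBall_mem_nhds L hε)
  obtain ⟨P, hP, Q, hQ, hPQ⟩ := eventually_prod_iff.1 hev
  obtain ⟨δ, hδ, hball⟩ := Metric.mem_nhdsWithin_iff.1 hQ
  have hconv : Convex ℝ (Metric.ball t δ ∩ I) := (convex_ball t δ).inter hI.convex
  filter_upwards [inter_mem_nhdsWithin I (Metric.ball_mem_nhds t hδ)] with s hs
  have hlim : Tendsto (fun n => ‖f n s - f n t - (s - t) • L‖) atTop
      (𝓝 ‖g s - g t - (s - t) • L‖) :=
    (((hg s hs.1).sub (hg t ht)).sub tendsto_const_nhds).norm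
  refine le_of_tendsto hlim (hP.mono fun n hn => ?_)
  have hder : ∀ r ∈ Metric.ball t δ ∩ I,
      HasDerivWithinAt (fun r => f n r - r • L) (f' n r - L) (Metric.ball t δ ∩ I) r := by
    intro r hr
    simpa [Pi.sub_def] using ((hf n r hr.2).mono inter_subset_right).sub
      ((hasDerivWithinAt_id r _).smul_const L)
  have hbound : ∀ r ∈ Metric.ball t δ ∩ I, ‖f' n r - L‖ ≤ ε := fun r hr => by
    simpa [dist_eq_norm] using hPQ hn (hball hr)
  have hmv := hconv.norm_image_sub_le_of_norm_hasDerivWithin_le hder hbound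
    ⟨Metric.mem_ball_self hδ, ht⟩ ⟨hs.2, hs.1⟩
  rwa [sub_sub_sub_comm, ← sub_smul] at hmv

/-- Limits of parallel lifts.  Let `A` be a continuous connection form on
`Ω × W` and `I ⊆ ℝ` an interval.  If `C¹` curves `xₙ : I → Ω` converge to a `C¹` curve
`x : I → Ω` in the `C¹` topology (i.e. `xₙ → x` and `xₙ′ → x′` uniformly on compact subsets of
`I`), each `ξₙ` is a parallel lift of `xₙ`, and `ξₙ → ξ` uniformly on compact subsets of `I`,
then `ξ` is `C¹` and a parallel lift of `x`. -/
theorem statement11 {V W : Type*} [NormedAddCommGroup V] [NormedSpace ℝ V]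
    [NormedAddCommGroup W] [NormedSpace ℝ W]
    (Ω : Set V) (hΩ : IsOpen Ω)
    (A : V → V →L[ℝ] W →L[ℝ] W) (hA : ContinuousOn A Ω)
    (I : Set ℝ) (hI : I.OrdConnected)
    (x x' : ℝ → V) (xn xn' : ℕ → ℝ → V) (ξn : ℕ → ℝ → W) (ξ : ℝ → W)
    (hxmem : ∀ t ∈ I, x t ∈ Ω)
    (hx : ∀ t ∈ I, HasDerivWithinAt x (x' t) I t) (hx'c : ContinuousOn x' I)
    (hxnmem : ∀ n, ∀ t ∈ I, xn n t ∈ Ω)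
    (hxn : ∀ n, ∀ t ∈ I, HasDerivWithinAt (xn n) (xn' n t) I t)
    (hxn'c : ∀ n, ContinuousOn (xn' n) I)
    (hξn : ∀ n, ∀ t ∈ I, HasDerivWithinAt (ξn n) (-(A (xn n t) (xn' n t) (ξn n t))) I t)
    (hconv : ∀ K ⊆ I, IsCompact K → TendstoUniformlyOn (fun n => xn n) x Filter.atTop K)
    (hconv' : ∀ K ⊆ I, IsCompact K → TendstoUniformlyOn (fun n => xn' n) x' Filter.atTop K)
    (hξconv : ∀ K ⊆ I, IsCompact K → TendstoUniformlyOn (fun n => ξn n) ξ Filter.atTop K) :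
    ContinuousOn ξ I ∧ ∀ t ∈ I, HasDerivWithinAt ξ (-(A (x t) (x' t) (ξ t))) I t := by
  have hderiv : ∀ t ∈ I, HasDerivWithinAt ξ (-(A (x t) (x' t) (ξ t))) I t := by
    intro t ht
    obtain ⟨K, hKI, hK, htK, hKt⟩ := hI.exists_isCompact_mem_nhdsWithin ht
    have hle : (Filter.atTop : Filter ℕ) ×ˢ 𝓝[I] t ≤ Filter.atTop ×ˢ 𝓝[K] t :=
      Filter.prod_mono le_rfl (nhdsWithin_le_iff.2 hKt)
    have hξc : ContinuousOn ξ K := (hξconv K hKI hK).continuousOn <|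
      Filter.Frequently.of_forall fun n s hs => ((hξn n s (hKI hs)).mono hKI).continuousWithinAt
    have hξt := ((hξconv K hKI hK).tendsto_uncurry_nhdsWithin (hξc t htK)).mono_left hle
    have hx't := ((hconv' K hKI hK).tendsto_uncurry_nhdsWithin
      ((hx'c t ht).mono hKI)).mono_left hle
    have hxt := ((hconv K hKI hK).tendsto_uncurry_nhdsWithin
      ((hx t ht).continuousWithinAt.mono hKI)).mono_left hle
    have hmem : ∀ᶠ p : ℕ × ℝ in Filter.atTop ×ˢ 𝓝[I] t, xn p.1 p.2 ∈ Ω :=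
      (Filter.tendsto_snd.eventually eventually_mem_nhdsWithin).mono fun p hp => hxnmem p.1 p.2 hp
    have hAt : Filter.Tendsto (fun p : ℕ × ℝ => A (xn p.1 p.2)) (Filter.atTop ×ˢ 𝓝[I] t)
        (𝓝 (A (x t))) := (hA (x t) (hxmem t ht)).tendsto.comp
      (tendsto_nhdsWithin_iff.2 ⟨hxt, hmem⟩)
    have hcont : Continuous fun q : (V →L[ℝ] W →L[ℝ] W) × V × W => -(q.1 q.2.1 q.2.2) := by
      fun_prop
    refine hI.hasDerivWithinAt_of_tendsto_prod ht hξn (fun s hs => ?_)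
      ((hcont.tendsto (A (x t), x' t, ξ t)).comp
        (hAt.prodMk_nhds (hx't.prodMk_nhds hξt)))
    exact (hξconv {s} (Set.singleton_subset_iff.2 hs) isCompact_singleton).tendsto_at
      (Set.mem_singleton s)
  exact ⟨fun t ht => (hderiv t ht).continuousWithinAt, hderiv⟩
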